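/- Let W(x) = (x−1)^4 (x^2 + Sx + S^2/4)(x^2 + Mx + N) with real numbers S, M, N satisfying 8 − 2√10 ≤ S < 4 and N ≥ M^2/4. Then W does not define any of the sign patterns (+,−,−,+,−,+,−,+,+), (+,−,−,+,−,+,+,+,+), or (+,−,−,−,−,+,−,+,+). -/

import Mathlib

open Polynomial

/-- A degree-8 real polynomial `P` defines the sign pattern `σ = (σ_0, …, σ_8)`
(with entries `1` for `+`, `-1` for `−`) if for each `j` the coefficient of
`x^(8-j)` is nonzero and has sign `σ_j`. -/
def definesSignPattern (P : Polynomial ℝ) (σ : Fin 9 → ℝ) : Prop :=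
  ∀ j : Fin 9, Real.sign (P.coeff (8 - (j : ℕ))) = σ j

lemma quintic_pos {S : ℝ} (hS : 1.67 ≤ S) :
    0 < 15 / 4 * S ^ 5 - 65 / 4 * S ^ 4 + 35 * S ^ 3 - 36 * S ^ 2 + 16 * S - 4 := by
  obtain ⟨u, hu, rfl⟩ : ∃ u : ℝ, 0 ≤ u ∧ S = 1.67 + u := ⟨S - 1.67, by linarith, by ring⟩
  ring_nf
  positivity

/-- Elimination of `M` and `N`: if `c * N < M * S`, the two linear forms `q1 + M * q2 + N * q3`
and `q2 + M * q3 + N * q4` cannot be positive and negative, respectively. -/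
lemma linear_forms_incompatible {S M N c q1 q2 q3 q4 : ℝ} (hc : 0 < c) (hM : 0 < M)
    (h1 : c * N < M * S) (hq1 : q1 < 0) (hq3 : 0 < q3) (hq4 : q4 ≤ 0)
    (hB : 0 < c * q3 + S * q4)
    (hD : 0 < q2 * (c * q2 + S * q3) - q1 * (c * q3 + S * q4))
    (h3 : 0 < q1 + M * q2 + N * q3) (h4 : q2 + M * q3 + N * q4 < 0) : False := by
  have h3' : 0 < c * q1 + M * (c * q2 + S * q3) := by
    linarith [mul_pos hc h3, mul_pos hq3 (sub_pos.2 h1)]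
  have h4' : c * q2 + M * (c * q3 + S * q4) < 0 := by
    linarith [mul_pos hc (neg_pos.2 h4), mul_nonneg (neg_nonneg.2 hq4) (sub_pos.2 h1).le]
  have hA : 0 < c * q2 + S * q3 := by
    by_contra! h
    linarith [mul_nonneg hM.le (neg_nonneg.2 h), mul_pos hc (neg_pos.2 hq1)]
  linarith [mul_pos hA (neg_pos.2 h4'), mul_pos hB h3', mul_pos hc hD]

/-- The constraints from the signs of the coefficients of `x`, `x^3` and `x^4`
are incompatible. -/
lemma low_coeff_signs_incompatible (S M N : ℝ) (hS : 8 - 2 * Real.sqrt 10 ≤ S) (hS' : S < 4)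
    (hN : 0 ≤ N) (h1 : 0 < M * (S ^ 2 / 4) + N * (S - S ^ 2))
    (h3 : 0 < (S - S ^ 2) + M * (1 - 4 * S + 3 * S ^ 2 / 2) + N * (-4 + 6 * S - S ^ 2))
    (h4 : (1 - 4 * S + 3 * S ^ 2 / 2) + M * (-4 + 6 * S - S ^ 2)
      + N * (6 - 4 * S + S ^ 2 / 4) < 0) : False := by
  have hs : Real.sqrt 10 ≤ 3.165 := by
    rw [Real.sqrt_le_left (by norm_num)]
    norm_num
  have hsq : Real.sqrt 10 ^ 2 = 10 := Real.sq_sqrt (by norm_num)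
  have hl : 1.67 ≤ S := by linarith
  have hS0 : 0 < S := by linarith
  have h1' : 4 * (S - 1) * N < M * S := by
    refine lt_of_mul_lt_mul_left ?_ hS0.le
    linarith
  have hM : 0 < M := by
    refine pos_of_mul_pos_left (h1'.trans_le' ?_) hS0.le
    exact mul_nonneg (by linarith) hN
  refine linear_forms_incompatible (by linarith : 0 < 4 * (S - 1)) hM h1' ?_ ?_ ?_ ?_ ?_ h3 h4
  · nlinarith
  · nlinarith
  · nlinarith
  · nlinarith [mul_nonneg (sub_nonneg.2 hl) (sub_pos.2 hS').le,
      mul_nonneg (mul_nonneg (sub_nonneg.2 hl) (sub_pos.2 hS').le) (sub_nonneg.2 hl)]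
  · linarith [quintic_pos hl]

/-- The octic polynomial in expanded form. -/
lemma octic_expand (S M N : ℝ) :
    ((X - 1) ^ 4 * (X ^ 2 + C S * X + C (S ^ 2 / 4)) * (X ^ 2 + C M * X + C N) : ℝ[X]) =
      X ^ 8 + C (S - 4 + M) * X ^ 7
        + C ((6 - 4 * S + S ^ 2 / 4) + M * (S - 4) + N) * X ^ 6
        + C ((-4 + 6 * S - S ^ 2) + M * (6 - 4 * S + S ^ 2 / 4) + N * (S - 4)) * X ^ 5
        + C ((1 - 4 * S + 3 * S ^ 2 / 2) + M * (-4 + 6 * S - S ^ 2)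
          + N * (6 - 4 * S + S ^ 2 / 4)) * X ^ 4
        + C ((S - S ^ 2) + M * (1 - 4 * S + 3 * S ^ 2 / 2) + N * (-4 + 6 * S - S ^ 2)) * X ^ 3
        + C (S ^ 2 / 4 + M * (S - S ^ 2) + N * (1 - 4 * S + 3 * S ^ 2 / 2)) * X ^ 2
        + C (M * (S ^ 2 / 4) + N * (S - S ^ 2)) * X + C (N * (S ^ 2 / 4)) := by
  refine Polynomial.funext fun x => ?_
  simp only [eval_add, eval_mul, eval_pow, eval_sub, eval_X, eval_C, eval_one]
  ring

lemma pos_of_sign_eq_one {x : ℝ} (h : Real.sign x = 1) : 0 < x := by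
  rcases lt_trichotomy x 0 with hx | hx | hx
  · rw [Real.sign_of_neg hx] at h
    norm_num at h
  · rw [hx, Real.sign_zero] at h
    norm_num at h
  · exact hx

lemma neg_of_sign_eq_neg_one {x : ℝ} (h : Real.sign x = -1) : x < 0 := by
  rw [← neg_pos]
  exact pos_of_sign_eq_one (by rw [Real.sign_neg, h, neg_neg])

/-- No sign pattern with `σ_4 = −`, `σ_5 = +`, `σ_7 = +` is defined by the octic. -/
lemma not_definesSignPattern_octic (S M N : ℝ) (hS : 8 - 2 * Real.sqrt 10 ≤ S) (hS' : S < 4)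
    (hN : M ^ 2 / 4 ≤ N) (σ : Fin 9 → ℝ) (h4 : σ 4 = -1) (h5 : σ 5 = 1) (h7 : σ 7 = 1) :
    ¬ definesSignPattern
        ((X - 1) ^ 4 * (X ^ 2 + C S * X + C (S ^ 2 / 4)) *
          (X ^ 2 + C M * X + C N)) σ := by
  intro h
  rw [octic_expand] at h
  have e4 := neg_of_sign_eq_neg_one ((h 4).trans h4)
  have e5 := pos_of_sign_eq_one ((h 5).trans h5)
  have e7 := pos_of_sign_eq_one ((h 7).trans h7)
  simp [coeff_C, coeff_X_pow, -map_add, -map_sub, -map_mul, -map_neg, -map_pow] at e4 e5 e7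
  exact low_coeff_signs_incompatible S M N hS hS' ((by positivity : 0 ≤ M ^ 2 / 4).trans hN)
    e7 e5 e4

/-- For `S` in the given range and `N ≥ M²/4`, the polynomial
`W = (x−1)⁴ (x² + Sx + S²/4)(x² + Mx + N)` does not define any of the sign
patterns (+,−,−,+,−,+,−,+,+), (+,−,−,+,−,+,+,+,+), (+,−,−,−,−,+,−,+,+). -/
theorem stmt17 (S M N : ℝ) (hS : 8 - 2 * Real.sqrt 10 ≤ S) (hS' : S < 4) (hN : M ^ 2 / 4 ≤ N) :
    ¬ definesSignPattern
        ((X - 1) ^ 4 * (X ^ 2 + C S * X + C (S ^ 2 / 4)) *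
          (X ^ 2 + C M * X + C N)) ![1, -1, -1, 1, -1, 1, -1, 1, 1] ∧
    ¬ definesSignPattern
        ((X - 1) ^ 4 * (X ^ 2 + C S * X + C (S ^ 2 / 4)) *
          (X ^ 2 + C M * X + C N)) ![1, -1, -1, 1, -1, 1, 1, 1, 1] ∧
    ¬ definesSignPattern
        ((X - 1) ^ 4 * (X ^ 2 + C S * X + C (S ^ 2 / 4)) *
          (X ^ 2 + C M * X + C N)) ![1, -1, -1, -1, -1, 1, -1, 1, 1] := by
  refine ⟨?_, ?_, ?_⟩ <;>
    exact not_definesSignPattern_octic S M N hS hS' hN _ (by rfl) (by rfl) (by rfl)
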